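/- Let F ⊂ A := ℂ²⧸Λ' be the set of the 16 fixed points of the involution induced by γ₁ ∘ γ₂ on A. Then the map induced by γ₁ on A maps F bijectively to itself and acts on F without fixed points, so F decomposes into exactly 8 orbits of size 2 under the subgroup generated by the map induced by γ₁. -/

import Mathlib

noncomputable def gamma1 (e₁ : ℂ) : Equiv.Perm (ℂ × ℂ) :=
  (Equiv.addRight (e₁ / 2)).prodCongr (Equiv.neg ℂ)

noncomputable def gamma2 (e₂ : ℂ) : Equiv.Perm (ℂ × ℂ) :=
  (Equiv.neg ℂ).prodCongr (Equiv.addRight (e₂ / 2))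

noncomputable def tr (v : ℂ × ℂ) : Equiv.Perm (ℂ × ℂ) := Equiv.addRight v

noncomputable def Gam (e₁ e₁' e₂ e₂' : ℂ) : Subgroup (Equiv.Perm (ℂ × ℂ)) :=
  Subgroup.closure {gamma1 e₁, gamma2 e₂, tr (e₁, 0), tr (e₁', 0), tr (0, e₂), tr (0, e₂')}

noncomputable def Lam (e₁ e₁' e₂ e₂' : ℂ) : AddSubgroup (ℂ × ℂ) :=
  AddSubgroup.closure {(e₁, 0), (e₁', 0), (0, e₂), (0, e₂')}

lemma tr_apply (v z : ℂ × ℂ) : tr v z = z + v := rfl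

lemma tr_zero : tr (0 : ℂ × ℂ) = 1 := Equiv.ext fun z => by
  simp [tr_apply]

lemma tr_mul (v w : ℂ × ℂ) : tr v * tr w = tr (v + w) := Equiv.ext fun z => by
  simp only [Equiv.Perm.mul_apply, tr_apply]
  abel

lemma tr_inv (v : ℂ × ℂ) : (tr v)⁻¹ = tr (-v) :=
  inv_eq_of_mul_eq_one_right (by rw [tr_mul, add_neg_cancel, tr_zero])

noncomputable def TT (e₁ e₁' e₂ e₂' : ℂ) : Subgroup (Equiv.Perm (ℂ × ℂ)) where
  carrier := {g | ∃ v ∈ Lam e₁ e₁' e₂ e₂', g = tr v}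
  one_mem' := ⟨0, zero_mem _, tr_zero.symm⟩
  mul_mem' := by
    rintro a b ⟨v, hv, rfl⟩ ⟨w, hw, rfl⟩
    exact ⟨v + w, add_mem hv hw, tr_mul v w⟩
  inv_mem' := by
    rintro a ⟨v, hv, rfl⟩
    exact ⟨-v, neg_mem hv, tr_inv v⟩

lemma mem_Lam_iff {e₁ e₁' e₂ e₂' : ℂ} {v : ℂ × ℂ} :
    v ∈ Lam e₁ e₁' e₂ e₂' ↔
      ∃ a b c d : ℤ, v = (a * e₁ + b * e₁', c * e₂ + d * e₂') := by
  constructor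
  · intro hv
    induction hv using AddSubgroup.closure_induction with
    | mem v hv =>
      rcases hv with rfl | rfl | rfl | rfl
      · exact ⟨1, 0, 0, 0, by simp⟩
      · exact ⟨0, 1, 0, 0, by simp⟩
      · exact ⟨0, 0, 1, 0, by simp⟩
      · exact ⟨0, 0, 0, 1, by simp⟩
    | zero => exact ⟨0, 0, 0, 0, by ext <;> simp⟩
    | add v w _ _ hv hw =>
      obtain ⟨a, b, c, d, rfl⟩ := hv
      obtain ⟨a', b', c', d', rfl⟩ := hw
      refine ⟨a + a', b + b', c + c', d + d', ?_⟩
      ext1 <;> push_cast <;> simp <;> ring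
    | neg v _ hv =>
      obtain ⟨a, b, c, d, rfl⟩ := hv
      refine ⟨-a, -b, -c, -d, ?_⟩
      ext1 <;> simp <;> ring
  · rintro ⟨a, b, c, d, rfl⟩
    have hsub : ∀ v ∈ ({(e₁, 0), (e₁', 0), (0, e₂), (0, e₂')} : Set (ℂ × ℂ)),
        ∀ n : ℤ, n • v ∈ Lam e₁ e₁' e₂ e₂' :=
      fun v hv n => zsmul_mem (AddSubgroup.subset_closure hv) n
    have := add_mem (add_mem (hsub (e₁, 0) (by simp) a) (hsub (e₁', 0) (by simp) b))
      (add_mem (hsub (0, e₂) (by simp) c) (hsub (0, e₂') (by simp) d))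
    simpa using this

lemma real_coeffs_eq_of_linearIndependent {e e' : ℂ} (h : LinearIndependent ℝ ![e, e'])
    {s t s' t' : ℝ} (hst : (s : ℂ) * e + t * e' = s' * e + t' * e') : s = s' ∧ t = t' := by
  rw [LinearIndependent.pair_iff] at h
  have := h (s - s') (t - t') (by
    simp only [Complex.real_smul, Complex.ofReal_sub]
    linear_combination hst)
  exact ⟨sub_eq_zero.mp this.1, sub_eq_zero.mp this.2⟩

lemma half_coeffs_of_linearIndependent {e e' : ℂ} (h : LinearIndependent ℝ ![e, e'])
    {m n a b : ℤ} (hmn : ((m : ℂ) * e + n * e') / 2 = a * e + b * e') :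
    m = 2 * a ∧ n = 2 * b := by
  have := real_coeffs_eq_of_linearIndependent h (s := m) (t := n) (s' := 2 * a) (t' := 2 * b)
    (by push_cast; linear_combination 2 * hmn)
  exact_mod_cast this

/-- The points of the torus fixed by the involution induced by `γ₁ ∘ γ₂`, parametrized by
the half-lattice vectors `((a e₁ + b e₁') / 2, (c e₂ + d e₂') / 2)`. -/
noncomputable def halfPoint (e₁ e₁' e₂ e₂' : ℂ) (a b c d : ℤ) :
    (ℂ × ℂ) ⧸ Lam e₁ e₁' e₂ e₂' :=
  QuotientAddGroup.mk (e₁ / 4 + (a * e₁ + b * e₁') / 2, -(e₂ / 4) + (c * e₂ + d * e₂') / 2)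

lemma halfPoint_eq_iff {e₁ e₁' e₂ e₂' : ℂ} (h₁ : LinearIndependent ℝ ![e₁, e₁'])
    (h₂ : LinearIndependent ℝ ![e₂, e₂']) {a b c d a' b' c' d' : ℤ} :
    halfPoint e₁ e₁' e₂ e₂' a b c d = halfPoint e₁ e₁' e₂ e₂' a' b' c' d' ↔
      (2 ∣ a' - a ∧ 2 ∣ b' - b) ∧ 2 ∣ c' - c ∧ 2 ∣ d' - d := by
  rw [halfPoint, halfPoint, QuotientAddGroup.eq, mem_Lam_iff]
  simp only [Prod.neg_mk, Prod.mk_add_mk, Prod.mk.injEq]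
  constructor
  · rintro ⟨k, l, m, n, hx, hy⟩
    have hx' := half_coeffs_of_linearIndependent h₁ (m := a' - a) (n := b' - b) (a := k) (b := l)
      (by push_cast; linear_combination hx)
    have hy' := half_coeffs_of_linearIndependent h₂ (m := c' - c) (n := d' - d) (a := m) (b := n)
      (by push_cast; linear_combination hy)
    exact ⟨⟨⟨k, hx'.1⟩, ⟨l, hx'.2⟩⟩, ⟨m, hy'.1⟩, ⟨n, hy'.2⟩⟩
  · rintro ⟨⟨⟨k, hk⟩, ⟨l, hl⟩⟩, ⟨m, hm⟩, ⟨n, hn⟩⟩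
    obtain rfl : a' = a + 2 * k := by lia
    obtain rfl : b' = b + 2 * l := by lia
    obtain rfl : c' = c + 2 * m := by lia
    obtain rfl : d' = d + 2 * n := by lia
    exact ⟨k, l, m, n, by push_cast; ring, by push_cast; ring⟩

/-- The involution of the torus induced by `γ₁ ∘ γ₂`. -/
noncomputable def torusGamma12 (e₁ e₁' e₂ e₂' : ℂ) (x : (ℂ × ℂ) ⧸ Lam e₁ e₁' e₂ e₂') :
    (ℂ × ℂ) ⧸ Lam e₁ e₁' e₂ e₂' :=
  -x + QuotientAddGroup.mk (e₁ / 2, -(e₂ / 2))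

lemma torusGamma12_mk (e₁ e₁' e₂ e₂' : ℂ) (z : ℂ × ℂ) :
    torusGamma12 e₁ e₁' e₂ e₂' (QuotientAddGroup.mk z) =
      QuotientAddGroup.mk (gamma1 e₁ (gamma2 e₂ z)) := by
  rw [torusGamma12, ← QuotientAddGroup.mk_neg, ← QuotientAddGroup.mk_add]
  congr 1
  ext1 <;> simp [gamma1, gamma2]
  ring

lemma Lam_le_comap_reflection (e₁ e₁' e₂ e₂' : ℂ) :
    Lam e₁ e₁' e₂ e₂' ≤
      (Lam e₁ e₁' e₂ e₂').comap ((AddMonoidHom.id ℂ).prodMap (negAddMonoidHom : ℂ →+ ℂ)) := by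
  intro v hv
  obtain ⟨a, b, c, d, rfl⟩ := mem_Lam_iff.mp hv
  refine mem_Lam_iff.mpr ⟨a, b, -c, -d, ?_⟩
  ext <;> simp
  ring

/-- The map of the torus induced by `γ₁`. -/
noncomputable def torusGamma1 (e₁ e₁' e₂ e₂' : ℂ) (x : (ℂ × ℂ) ⧸ Lam e₁ e₁' e₂ e₂') :
    (ℂ × ℂ) ⧸ Lam e₁ e₁' e₂ e₂' :=
  QuotientAddGroup.map _ _ _ (Lam_le_comap_reflection e₁ e₁' e₂ e₂') x +
    QuotientAddGroup.mk (e₁ / 2, 0)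

lemma torusGamma1_mk (e₁ e₁' e₂ e₂' : ℂ) (z : ℂ × ℂ) :
    torusGamma1 e₁ e₁' e₂ e₂' (QuotientAddGroup.mk z) = QuotientAddGroup.mk (gamma1 e₁ z) := by
  rw [torusGamma1, QuotientAddGroup.map_mk, ← QuotientAddGroup.mk_add]
  congr 1
  ext <;> simp [gamma1]

lemma torusGamma1_torusGamma1 (e₁ e₁' e₂ e₂' : ℂ) (x : (ℂ × ℂ) ⧸ Lam e₁ e₁' e₂ e₂') :
    torusGamma1 e₁ e₁' e₂ e₂' (torusGamma1 e₁ e₁' e₂ e₂' x) = x := by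
  induction x using QuotientAddGroup.induction_on with
  | H z =>
    rw [torusGamma1_mk, torusGamma1_mk, eq_comm, QuotientAddGroup.eq, mem_Lam_iff]
    refine ⟨1, 0, 0, 0, ?_⟩
    ext1 <;> simp [gamma1]
    ring

lemma torusGamma12_eq_self_iff {e₁ e₁' e₂ e₂' : ℂ} {x : (ℂ × ℂ) ⧸ Lam e₁ e₁' e₂ e₂'} :
    torusGamma12 e₁ e₁' e₂ e₂' x = x ↔
      ∃ a b c d : ℤ, x = halfPoint e₁ e₁' e₂ e₂' a b c d := by
  constructor
  · induction x using QuotientAddGroup.induction_on with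
    | H z =>
      rw [torusGamma12_mk, QuotientAddGroup.eq, mem_Lam_iff]
      rintro ⟨a, b, c, d, h⟩
      refine ⟨a, b, c, d, congrArg _ ?_⟩
      simp only [gamma1, gamma2, Equiv.prodCongr_apply, Prod.ext_iff, Prod.map_fst, Prod.map_snd,
        Equiv.neg_apply, Equiv.coe_addRight, Prod.fst_add, Prod.snd_add, Prod.fst_neg,
        Prod.snd_neg] at h
      ext1
      · linear_combination h.1 / 2
      · linear_combination h.2 / 2
  · rintro ⟨a, b, c, d, rfl⟩
    rw [halfPoint, torusGamma12_mk, QuotientAddGroup.eq, mem_Lam_iff]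
    refine ⟨a, b, c, d, ?_⟩
    ext1 <;> simp [gamma1, gamma2] <;> ring

lemma torusGamma1_halfPoint (e₁ e₁' e₂ e₂' : ℂ) (a b c d : ℤ) :
    torusGamma1 e₁ e₁' e₂ e₂' (halfPoint e₁ e₁' e₂ e₂' a b c d) =
      halfPoint e₁ e₁' e₂ e₂' (a + 1) b (1 - c) (-d) := by
  rw [halfPoint, torusGamma1_mk]
  refine congrArg _ ?_
  ext1 <;> simp [gamma1] <;> ring

lemma ncard_fixedPoints_torusGamma12 {e₁ e₁' e₂ e₂' : ℂ}
    (h₁ : LinearIndependent ℝ ![e₁, e₁']) (h₂ : LinearIndependent ℝ ![e₂, e₂']) :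
    {x | torusGamma12 e₁ e₁' e₂ e₂' x = x}.ncard = 16 := by
  let p : (Fin 2 × Fin 2) × Fin 2 × Fin 2 → (ℂ × ℂ) ⧸ Lam e₁ e₁' e₂ e₂' := fun t =>
    halfPoint e₁ e₁' e₂ e₂' (t.1.1 : ℕ) (t.1.2 : ℕ) (t.2.1 : ℕ) (t.2.2 : ℕ)
  have hp : Function.Injective p := by
    rintro ⟨⟨a, b⟩, c, d⟩ ⟨⟨a', b'⟩, c', d'⟩ h
    have := (halfPoint_eq_iff h₁ h₂).mp h
    simp only [Prod.mk.injEq, Fin.ext_iff]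
    dsimp only at this
    omega
  have hrange : {x | torusGamma12 e₁ e₁' e₂ e₂' x = x} = Set.range p := by
    ext x
    rw [Set.mem_ofPred_eq, torusGamma12_eq_self_iff]
    constructor
    · rintro ⟨a, b, c, d, rfl⟩
      refine ⟨((⟨(a % 2).toNat, by lia⟩, ⟨(b % 2).toNat, by lia⟩),
        ⟨(c % 2).toNat, by lia⟩, ⟨(d % 2).toNat, by lia⟩), (halfPoint_eq_iff h₁ h₂).mpr ?_⟩
      dsimp only
      lia
    · rintro ⟨t, rfl⟩
      exact ⟨_, _, _, _, rfl⟩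
  rw [hrange, ← Set.image_univ, Set.ncard_image_of_injective _ hp, Set.ncard_univ]
  simp

/-- An involution without fixed points on a finite set splits it into pairs. -/
lemma ncard_eq_two_mul_ncard_pairs {α : Type*} {s : Set α} (hs : s.Finite) {g : α → α}
    (hmaps : Set.MapsTo g s s) (hne : ∀ x ∈ s, g x ≠ x) (hinv : ∀ x ∈ s, g (g x) = x) :
    s.ncard = 2 * {t : Set α | ∃ x, x ∈ s ∧ t = {x, g x}}.ncard := by
  classical
  lift s to Finset α using hs
  have himage : {t : Set α | ∃ x, x ∈ (s : Set α) ∧ t = {x, g x}} =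
      (s.image fun x => ({x, g x} : Set α) : Finset (Set α)) := by
    ext t
    simp [eq_comm]
  rw [himage, Set.ncard_coe_finset, Set.ncard_coe_finset,
    Finset.card_eq_sum_card_image (fun x => ({x, g x} : Set α)) s, mul_comm]
  refine Finset.sum_const_nat fun t ht => ?_
  obtain ⟨x, hx, rfl⟩ := Finset.mem_image.mp ht
  have hfiber : {y ∈ s | ({y, g y} : Set α) = {x, g x}} = {x, g x} := by
    ext y
    simp only [Finset.mem_filter, Finset.mem_insert, Finset.mem_singleton]
    constructor
    · rintro ⟨-, h⟩
      have hy : y ∈ ({x, g x} : Set α) := h ▸ Set.mem_insert y _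
      simpa using hy
    · rintro (rfl | rfl)
      · exact ⟨hx, rfl⟩
      · exact ⟨hmaps hx, by rw [hinv x hx, Set.pair_comm]⟩
  rw [hfiber, Finset.card_pair (hne x hx).symm]

/-- Let F ⊂ A = ℂ²⧸Λ' be the set of the 16 fixed points of the involution induced by
γ₁ ∘ γ₂. The map induced by γ₁ maps F bijectively to itself and acts on F without fixed
points, so F decomposes into exactly 8 orbits of size 2 under the subgroup generated by
the map induced by γ₁. -/
theorem stmt_18 (e₁ e₁' e₂ e₂' : ℂ)
    (h₁ : LinearIndependent ℝ ![e₁, e₁'])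
    (h₂ : LinearIndependent ℝ ![e₂, e₂']) :
    ∃ f g : ((ℂ × ℂ) ⧸ Lam e₁ e₁' e₂ e₂') → ((ℂ × ℂ) ⧸ Lam e₁ e₁' e₂ e₂'),
      (∀ z : ℂ × ℂ,
        f (QuotientAddGroup.mk z) = QuotientAddGroup.mk ((gamma1 e₁) ((gamma2 e₂) z))) ∧
      (∀ z : ℂ × ℂ, g (QuotientAddGroup.mk z) = QuotientAddGroup.mk (gamma1 e₁ z)) ∧
      Set.ncard {x : (ℂ × ℂ) ⧸ Lam e₁ e₁' e₂ e₂' | f x = x} = 16 ∧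
      Set.BijOn g {x | f x = x} {x | f x = x} ∧
      (∀ x, f x = x → g x ≠ x) ∧
      (∀ x, f x = x → g (g x) = x) ∧
      Set.ncard {s : Set ((ℂ × ℂ) ⧸ Lam e₁ e₁' e₂ e₂') |
        ∃ x, f x = x ∧ s = {x, g x}} = 8 ∧
      (∀ x, f x = x → ({x, g x} : Set ((ℂ × ℂ) ⧸ Lam e₁ e₁' e₂ e₂')).ncard = 2) := by
  have hcard := ncard_fixedPoints_torusGamma12 h₁ h₂
  have hinv := torusGamma1_torusGamma1 e₁ e₁' e₂ e₂'
  have hmaps : Set.MapsTo (torusGamma1 e₁ e₁' e₂ e₂')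
      {x | torusGamma12 e₁ e₁' e₂ e₂' x = x} {x | torusGamma12 e₁ e₁' e₂ e₂' x = x} := by
    intro x hx
    obtain ⟨a, b, c, d, rfl⟩ := torusGamma12_eq_self_iff.mp hx
    exact torusGamma12_eq_self_iff.mpr ⟨_, _, _, _, torusGamma1_halfPoint ..⟩
  have hne : ∀ x, torusGamma12 e₁ e₁' e₂ e₂' x = x → torusGamma1 e₁ e₁' e₂ e₂' x ≠ x := by
    intro x hx
    obtain ⟨a, b, c, d, rfl⟩ := torusGamma12_eq_self_iff.mp hx
    rw [torusGamma1_halfPoint, Ne, halfPoint_eq_iff h₁ h₂]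
    lia
  have hpairs := ncard_eq_two_mul_ncard_pairs (Set.finite_of_ncard_ne_zero (by simp [hcard]))
    hmaps hne fun x _ => hinv x
  refine ⟨torusGamma12 e₁ e₁' e₂ e₂', torusGamma1 e₁ e₁' e₂ e₂', torusGamma12_mk e₁ e₁' e₂ e₂',
    torusGamma1_mk e₁ e₁' e₂ e₂', hcard, ?_, hne, fun x _ => hinv x, ?_,
    fun x hx => Set.ncard_pair (hne x hx).symm⟩
  · exact ⟨hmaps, (Function.LeftInverse.injective hinv).injOn,
      fun x hx => ⟨_, hmaps hx, hinv x⟩⟩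
  · simp only [Set.mem_ofPred_eq] at hpairs
    lia
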